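/- Let X and Y be independent random variables on a probability space (Ω, 𝓕, ℙ), where X has the log-normal distribution with parameters μ = 0 and σ > 0 and Y has the Pareto distribution with shape a > 0 and scale θ > 0. Then the product Z = X·Y has probability density function f_Z(z) = (1/(σ·z))·φ( log(z/θ)/σ ) + ( a·θ^a·exp(a²σ²/2)/z^{a+1} )·Φ( (log(z/θ) − a·σ²)/σ ) − ( θ^a·exp(a²σ²/2)/(σ·z^{a+1}) )·φ( (log(z/θ) − a·σ²)/σ ) for z > 0, and f_Z(z) = 0 for z ≤ 0, where φ and Φ are the probability density function and the cumulative distribution function of the standard Gaussian distribution. -/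

import Mathlib

open MeasureTheory ProbabilityTheory Real

/-- The Pareto probability density function with shape `a` and scale `θ`. -/
noncomputable def paretoPdf (a θ x : ℝ) : ℝ :=
  if θ < x then a * θ ^ a * x ^ (-(a + 1)) else 0

/-- The log-normal probability density function with parameters `μ` and `σ`. -/
noncomputable def logNormalPdf (μ σ x : ℝ) : ℝ :=
  if 0 < x then
    (1 / (Real.sqrt (2 * π) * σ * x)) * Real.exp (-(Real.log x - μ) ^ 2 / (2 * σ ^ 2))
  else 0

/-- The standard Gaussian probability density function. -/
noncomputable def stdGaussPdf (u : ℝ) : ℝ :=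
  (1 / Real.sqrt (2 * π)) * Real.exp (-u ^ 2 / 2)

/-- The standard Gaussian cumulative distribution function. -/
noncomputable def stdGaussCdf (u : ℝ) : ℝ :=
  ∫ t in Set.Iic u, stdGaussPdf t

/-- The density of the product of two independent random variables with densities `f` and `g`,
the second of which is positive. -/
theorem map_mul_prod_withDensity {f g : ℝ → ENNReal} (hf : Measurable f) (hg : Measurable g)
    (hg0 : ∀ y ≤ 0, g y = 0) :
    (((volume : Measure ℝ).withDensity f).prod ((volume : Measure ℝ).withDensity g)).map
        (fun p : ℝ × ℝ => p.1 * p.2)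
      = (volume : Measure ℝ).withDensity
          (fun z => ∫⁻ y, g y * (ENNReal.ofReal y⁻¹ * f (z / y))) := by
  ext s hs
  set i : ℝ → ENNReal := s.indicator 1
  have him : Measurable i := measurable_one.indicator hs
  have key : ∀ y, g y * ∫⁻ x, f x * i (x * y)
      = ∫⁻ z, i z * (g y * (ENNReal.ofReal y⁻¹ * f (z / y))) := by
    intro y
    rcases le_or_gt y 0 with hy | hy
    · simp [hg0 y hy]
    · conv_rhs => rw [← Real.smul_map_volume_mul_right hy.ne']
      rw [lintegral_smul_measure, lintegral_map (by fun_prop) (by fun_prop), smul_eq_mul,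
        ← lintegral_const_mul _ (by fun_prop), ← lintegral_const_mul _ (by fun_prop)]
      refine lintegral_congr fun x => ?_
      rw [mul_div_cancel_right₀ _ hy.ne', abs_of_pos hy]
      have h1 : ENNReal.ofReal y * ENNReal.ofReal y⁻¹ = 1 := by
        rw [← ENNReal.ofReal_mul hy.le, mul_inv_cancel₀ hy.ne', ENNReal.ofReal_one]
      calc g y * (f x * i (x * y))
          = (ENNReal.ofReal y * ENNReal.ofReal y⁻¹) * (g y * (f x * i (x * y))) := by
            rw [h1, one_mul]
        _ = _ := by ring
  rw [← lintegral_indicator_one hs, lintegral_map him (by fun_prop),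
    lintegral_prod_symm' _ (by fun_prop), lintegral_withDensity_eq_lintegral_mul _ hg (by fun_prop),
    ← lintegral_indicator_one hs,
    lintegral_withDensity_eq_lintegral_mul _ (by fun_prop) him]
  simp only [Pi.mul_apply]
  calc ∫⁻ y, g y * ∫⁻ x, i (x * y) ∂(volume : Measure ℝ).withDensity f
      = ∫⁻ y, ∫⁻ z, i z * (g y * (ENNReal.ofReal y⁻¹ * f (z / y))) := by
        refine lintegral_congr fun y => ?_
        rw [← key, lintegral_withDensity_eq_lintegral_mul _ hf (by fun_prop)]
        rfl
    _ = ∫⁻ z, ∫⁻ y, i z * (g y * (ENNReal.ofReal y⁻¹ * f (z / y))) :=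
        lintegral_lintegral_swap (by fun_prop)
    _ = _ := by
        refine lintegral_congr fun z => ?_
        rw [lintegral_const_mul _ (by fun_prop), mul_comm]

@[fun_prop]
theorem measurable_paretoPdf (a θ : ℝ) : Measurable (paretoPdf a θ) :=
  Measurable.ite measurableSet_Ioi (by fun_prop) measurable_const

@[fun_prop]
theorem measurable_logNormalPdf (μ σ : ℝ) : Measurable (logNormalPdf μ σ) :=
  Measurable.ite measurableSet_Ioi (by fun_prop) measurable_const

theorem stdGaussPdf_nonneg (u : ℝ) : 0 ≤ stdGaussPdf u := by
  unfold stdGaussPdf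
  positivity

theorem integrable_stdGaussPdf : Integrable stdGaussPdf := by
  refine ((integrable_exp_neg_mul_sq (b := 1 / 2) (by norm_num)).const_mul
    (1 / Real.sqrt (2 * π))).congr (ae_of_all _ fun u => ?_)
  simp only [stdGaussPdf]
  ring_nf

theorem lintegral_Iio_ofReal_const_mul_stdGaussPdf {c : ℝ} (hc : 0 ≤ c) (b : ℝ) :
    ∫⁻ u in Set.Iio b, ENNReal.ofReal (c * stdGaussPdf u)
      = ENNReal.ofReal (c * stdGaussCdf b) := by
  rw [setLIntegral_congr Iio_ae_eq_Iic, ← ofReal_integral_eq_lintegral_ofReal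
    (integrable_stdGaussPdf.integrableOn.const_mul c)
    (ae_of_all _ fun u => mul_nonneg hc (stdGaussPdf_nonneg u)), integral_const_mul]
  rfl

/-- The two Gaussian density terms in the density of the product cancel. -/
theorem gaussian_terms_cancel {a θ σ z : ℝ} (hθ : 0 < θ) (hσ : 0 < σ) (hz : 0 < z) (t : ℝ) :
    (1 / (σ * z)) * stdGaussPdf (Real.log (z / θ) / σ) + t
        - (θ ^ a * Real.exp (a ^ 2 * σ ^ 2 / 2) / (σ * z ^ (a + 1)))
          * stdGaussPdf ((Real.log (z / θ) - a * σ ^ 2) / σ) = t := by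
  have hexp : θ ^ a * Real.exp (a ^ 2 * σ ^ 2 / 2)
        * Real.exp (-((Real.log (z / θ) - a * σ ^ 2) / σ) ^ 2 / 2)
      = z ^ a * Real.exp (-(Real.log (z / θ) / σ) ^ 2 / 2) := by
    rw [Real.rpow_def_of_pos hθ, Real.rpow_def_of_pos hz, ← Real.exp_add, ← Real.exp_add,
      ← Real.exp_add, Real.log_div hz.ne' hθ.ne']
    congr 1
    field_simp
    ring
  have hz' : (z ^ a) ≠ 0 := (Real.rpow_pos_of_pos hz a).ne'
  have : (θ ^ a * Real.exp (a ^ 2 * σ ^ 2 / 2) / (σ * z ^ (a + 1)))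
          * stdGaussPdf ((Real.log (z / θ) - a * σ ^ 2) / σ)
      = (1 / (σ * z)) * stdGaussPdf (Real.log (z / θ) / σ) := by
    unfold stdGaussPdf
    rw [Real.rpow_add_one hz.ne']
    calc _ = (θ ^ a * Real.exp (a ^ 2 * σ ^ 2 / 2)
          * Real.exp (-((Real.log (z / θ) - a * σ ^ 2) / σ) ^ 2 / 2))
            / (σ * (z ^ a * z)) * (1 / Real.sqrt (2 * π)) := by ring
      _ = _ := by
        rw [hexp]
        field_simp
  rw [this]
  ring

theorem lintegral_paretoPdf_mul_logNormalPdf {a θ σ z : ℝ} (ha : 0 < a) (hθ : 0 < θ) (hσ : 0 < σ)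
    (hz : 0 < z) :
    ∫⁻ y, ENNReal.ofReal (paretoPdf a θ y)
        * (ENNReal.ofReal y⁻¹ * ENNReal.ofReal (logNormalPdf 0 σ (z / y)))
      = ENNReal.ofReal ((a * θ ^ a * Real.exp (a ^ 2 * σ ^ 2 / 2) / z ^ (a + 1))
          * stdGaussCdf ((Real.log (z / θ) - a * σ ^ 2) / σ)) := by
  set b := (Real.log (z / θ) - a * σ ^ 2) / σ with hb
  set T : ℝ → ℝ := fun u => z * Real.exp (-(σ * u) - a * σ ^ 2) with hT
  have hTpos : ∀ u, 0 < T u := fun u => by positivity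
  have hlogT : ∀ u, Real.log (T u) = Real.log z + (-(σ * u) - a * σ ^ 2) := fun u => by
    rw [hT, Real.log_mul hz.ne' (Real.exp_pos _).ne', Real.log_exp]
  have hTlt : ∀ u, θ < T u ↔ u < b := fun u => by
    rw [← Real.log_lt_log_iff hθ (hTpos u), hlogT, hb, lt_div_iff₀ hσ,
      Real.log_div hz.ne' hθ.ne']
    constructor <;> intro h <;> linarith
  have himage : T '' Set.Iio b = Set.Ioi θ := by
    ext y
    constructor
    · rintro ⟨u, hu, rfl⟩
      exact (hTlt u).2 hu
    · intro hy
      have hy0 : 0 < y := hθ.trans hy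
      have hTy : T ((Real.log z - Real.log y - a * σ ^ 2) / σ) = y := by
        refine Real.log_injOn_pos (hTpos _) hy0 ?_
        rw [hlogT]
        field_simp
        ring
      exact ⟨_, (hTlt _).1 (hTy.symm ▸ hy), hTy⟩
  have hinj : Function.Injective T := fun u v huv => by
    have := congrArg Real.log huv
    rw [hlogT, hlogT] at this
    exact mul_left_cancel₀ hσ.ne' (by linarith)
  have hderiv : ∀ u, HasDerivAt T (-(σ * T u)) u := fun u => by
    have h : HasDerivAt (fun u : ℝ => -(σ * u) - a * σ ^ 2) (-(σ * 1)) u :=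
      (((hasDerivAt_id u).const_mul σ).neg).sub_const _
    exact (h.exp.const_mul z).congr_deriv (by simp only [hT]; ring)
  have hsupp : ∫⁻ y, ENNReal.ofReal (paretoPdf a θ y)
        * (ENNReal.ofReal y⁻¹ * ENNReal.ofReal (logNormalPdf 0 σ (z / y)))
      = ∫⁻ y in Set.Ioi θ, ENNReal.ofReal (paretoPdf a θ y)
        * (ENNReal.ofReal y⁻¹ * ENNReal.ofReal (logNormalPdf 0 σ (z / y))) := by
    refine (setLIntegral_eq_of_support_subset ?_).symm
    intro y hy
    by_contra hy'
    exact hy (by simp [paretoPdf, show ¬ θ < y from hy'])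
  rw [hsupp, ← himage, lintegral_image_eq_lintegral_abs_deriv_mul measurableSet_Iio
    (fun u _ => (hderiv u).hasDerivWithinAt) hinj.injOn,
    ← lintegral_Iio_ofReal_const_mul_stdGaussPdf (by positivity)]
  refine setLIntegral_congr_fun measurableSet_Iio fun u hu => ?_
  have hT0 := hTpos u
  have hpareto : 0 ≤ a * θ ^ a * T u ^ (-(a + 1)) := by positivity
  simp only [paretoPdf, if_pos ((hTlt u).2 hu), logNormalPdf, if_pos (div_pos hz hT0)]
  rw [← ENNReal.ofReal_mul (by positivity), ← ENNReal.ofReal_mul hpareto,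
    ← ENNReal.ofReal_mul (abs_nonneg _), abs_neg, abs_of_pos (by positivity : 0 < σ * T u)]
  congr 1
  have hexp : T u ^ (-a) * Real.exp (-(Real.log (z / T u) - 0) ^ 2 / (2 * σ ^ 2))
      = Real.exp (a ^ 2 * σ ^ 2 / 2) * Real.exp (-u ^ 2 / 2) * z ^ (-a) := by
    rw [Real.rpow_def_of_pos hT0, Real.rpow_def_of_pos hz, ← Real.exp_add, ← Real.exp_add,
      ← Real.exp_add, Real.log_div hz.ne' hT0.ne', hlogT]
    congr 1
    field_simp
    ring
  have hTpow : T u ^ (-(a + 1)) = T u ^ (-a) * (T u)⁻¹ := by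
    rw [neg_add, ← sub_eq_add_neg, Real.rpow_sub_one hT0.ne', div_eq_mul_inv]
  have hzpow : z ^ (a + 1) = (z ^ (-a))⁻¹ * z := by
    rw [Real.rpow_add_one hz.ne', Real.rpow_neg hz.le, inv_inv]
  have hza : z ^ (-a) ≠ 0 := (Real.rpow_pos_of_pos hz _).ne'
  rw [hTpow, hzpow, stdGaussPdf]
  calc _ = (a * θ ^ a / (Real.sqrt (2 * π) * z)) *
        (T u ^ (-a) * Real.exp (-(Real.log (z / T u) - 0) ^ 2 / (2 * σ ^ 2))) := by
        field_simp
    _ = _ := by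
        rw [hexp]
        field_simp

theorem product_of_lognormal_pareto_pdf
    {Ω : Type*} [MeasurableSpace Ω] (P : Measure Ω) [IsProbabilityMeasure P]
    (X Y : Ω → ℝ) (hXm : Measurable X) (hYm : Measurable Y)
    (hindep : IndepFun X Y P)
    (a θ σ : ℝ) (ha : 0 < a) (hθ : 0 < θ) (hσ : 0 < σ)
    (hX : Measure.map X P
      = (volume : Measure ℝ).withDensity (fun x => ENNReal.ofReal (logNormalPdf 0 σ x)))
    (hY : Measure.map Y P
      = (volume : Measure ℝ).withDensity (fun y => ENNReal.ofReal (paretoPdf a θ y))) :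
    Measure.map (fun ω => X ω * Y ω) P
      = (volume : Measure ℝ).withDensity (fun z => ENNReal.ofReal
          (if 0 < z then
            (1 / (σ * z)) * stdGaussPdf (Real.log (z / θ) / σ)
              + (a * θ ^ a * Real.exp (a ^ 2 * σ ^ 2 / 2) / z ^ (a + 1))
                  * stdGaussCdf ((Real.log (z / θ) - a * σ ^ 2) / σ)
              - (θ ^ a * Real.exp (a ^ 2 * σ ^ 2 / 2) / (σ * z ^ (a + 1)))
                  * stdGaussPdf ((Real.log (z / θ) - a * σ ^ 2) / σ)
          else 0)) := by
  have hmap : Measure.map (fun ω => X ω * Y ω) P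
      = (P.map fun ω => (X ω, Y ω)).map fun p : ℝ × ℝ => p.1 * p.2 :=
    (Measure.map_map (measurable_fst.mul measurable_snd) (hXm.prodMk hYm)).symm
  rw [hmap, (indepFun_iff_map_prod_eq_prod_map_map hXm.aemeasurable hYm.aemeasurable).mp hindep, hX, hY,
    map_mul_prod_withDensity (measurable_logNormalPdf 0 σ).ennreal_ofReal
      (measurable_paretoPdf a θ).ennreal_ofReal]
  · congr 1
    funext z
    split_ifs with hz
    · rw [lintegral_paretoPdf_mul_logNormalPdf ha hθ hσ hz, gaussian_terms_cancel hθ hσ hz]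
    · rw [ENNReal.ofReal_zero]
      refine lintegral_eq_zero_of_ae_eq_zero (ae_of_all _ fun y => ?_)
      rcases le_or_gt y θ with hy | hy
      · simp [paretoPdf, hy.not_gt]
      · have : ¬ 0 < z / y := (div_nonpos_of_nonpos_of_nonneg (not_lt.mp hz) (hθ.trans hy).le).not_gt
        simp [logNormalPdf, this]
  · intro y hy
    simp [paretoPdf, (hy.trans hθ.le).not_gt]
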